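/- arXiv:2205.09056 — 2 statements merged into one kernel-verified Lean document; each statement's English description precedes it below -/
import Mathlib

section
/- Let (π_t)_{t≥1} be a sequence of policies with ‖π_{t+1} − π_t‖_{1,∞} ≤ c_T for every t, let T ≥ 1 be a real number, and let H be a natural number with γ^H ≤ (1−γ)/√T. Then for every t ≥ 1 and every (s,a) ∈ 𝒮 × 𝒜: |Ū_t(s,a) − Q^{π_t}(s,a)| ≤ (H·S + H²·A)·c_T/(1−γ) + 1/√T. -/
open Finset

/-- A policy: nonnegative, rows sum to one. -/
def IsPolicy {S A : Type*} [Fintype A] (π : S → A → ℝ) : Prop :=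
  (∀ s a, 0 ≤ π s a) ∧ ∀ s, ∑ a, π s a = 1

/-- A transition function: nonnegative, rows sum to one. -/
def IsTransition {S A : Type*} [Fintype S] (P : S → A → S → ℝ) : Prop :=
  (∀ s a s', 0 ≤ P s a s') ∧ ∀ s a, ∑ s', P s a s' = 1

/-- A state distribution. -/
def IsDistribution {S : Type*} [Fintype S] (d : S → ℝ) : Prop :=
  (∀ s, 0 ≤ d s) ∧ ∑ s, d s = 1

/-- The row-stochastic matrix 𝐏^π induced by a policy π. -/
def pmat {S A : Type*} [Fintype A] (P : S → A → S → ℝ) (π : S → A → ℝ) : S → S → ℝ :=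
  fun s s' => ∑ a, π s a * P s a s'

/-- Action of a distribution (row vector) on a matrix: (dM)(s') = Σ_s d(s) M(s,s'). -/
def dApply {S : Type*} [Fintype S] (d : S → ℝ) (M : S → S → ℝ) : S → ℝ :=
  fun s' => ∑ s, d s * M s s'

/-- ℓ¹ norm of a vector over a finite state space. -/
def l1 {S : Type*} [Fintype S] (v : S → ℝ) : ℝ := ∑ s, |v s|

/-- Iterated action of the kernels 𝐏^{πs 0}, 𝐏^{πs 1}, … on an initial distribution d:
`rollout P πs d k = d · 𝐏^{πs 0} ⋯ 𝐏^{πs (k-1)}`. -/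
def rollout {S A : Type*} [Fintype S] [Fintype A] (P : S → A → S → ℝ)
    (πs : ℕ → S → A → ℝ) (d : S → ℝ) : ℕ → S → ℝ
  | 0 => d
  | k + 1 => dApply (rollout P πs d k) (pmat P (πs k))

/-- Expected one-step reward of a policy: r^π(s) = Σ_a π(a|s) r(s,a). -/
def rpol {S A : Type*} [Fintype A] (r : S → A → ℝ) (π : S → A → ℝ) : S → ℝ :=
  fun s => ∑ a, π s a * r s a

/-- The action-value function
`Q^π(s,a) = r(s,a) + Σ_{k=1}^∞ γ^k Σ_{s'} (𝐏(s,a,·)(𝐏^π)^{k−1})(s') r^π(s')`. -/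
noncomputable def Qval {S A : Type*} [Fintype S] [Fintype A] (γ : ℝ)
    (P : S → A → S → ℝ) (r : S → A → ℝ) (π : S → A → ℝ) (s : S) (a : A) : ℝ :=
  r s a + ∑' k : ℕ, γ ^ (k + 1) *
    ∑ s', rollout P (fun _ => π) (fun s'' => P s a s'') k s' * rpol r π s'

/-- The finite-horizon non-stationary value
`Ū_t(s,a) = r(s,a) + Σ_{k=1}^H γ^k Σ_{s'} d_k(s') r^{π_{t+k}}(s')`, where
`d_1 = 𝐏(s,a,·)` and `d_{k+1} = d_k 𝐏^{π_{t+k}}`. -/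
noncomputable def Ubar {S A : Type*} [Fintype S] [Fintype A] (γ : ℝ)
    (P : S → A → S → ℝ) (r : S → A → ℝ) (π : ℕ → S → A → ℝ) (t H : ℕ)
    (s : S) (a : A) : ℝ :=
  r s a + ∑ k ∈ Finset.range H, γ ^ (k + 1) *
    ∑ s', rollout P (fun j => π (t + 1 + j)) (fun s'' => P s a s'') k s' *
      rpol r (π (t + 1 + k)) s'

theorem aux_l1 {I J : Type*} [Fintype I] [Fintype J] (v : I → ℝ) (K : I → J → ℝ)
    (h0 : ∀ i j, 0 ≤ K i j) (h1 : ∀ i, ∑ j, K i j = 1) :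
    ∑ j, |∑ i, v i * K i j| ≤ ∑ i, |v i| := by
  calc ∑ j, |∑ i, v i * K i j| ≤ ∑ j, ∑ i, |v i| * K i j := by
        refine Finset.sum_le_sum fun j _ => ?_
        refine (Finset.abs_sum_le_sum_abs _ _).trans (le_of_eq ?_)
        refine Finset.sum_congr rfl fun i _ => ?_
        rw [abs_mul, abs_of_nonneg (h0 i j)]
    _ = ∑ i, |v i| := by
        rw [Finset.sum_comm]
        refine Finset.sum_congr rfl fun i _ => ?_
        rw [← Finset.mul_sum, h1, mul_one]

theorem aux_avg {I : Type*} [Fintype I] (d f : I → ℝ) (c : ℝ) (hd : IsDistribution d)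
    (hf : ∀ i, f i ≤ c) : ∑ i, d i * f i ≤ c := by
  calc ∑ i, d i * f i ≤ ∑ i, d i * c :=
        Finset.sum_le_sum fun i _ => mul_le_mul_of_nonneg_left (hf i) (hd.1 i)
    _ = c := by rw [← Finset.sum_mul, hd.2, one_mul]

theorem aux_dApply {S : Type*} [Fintype S] (d : S → ℝ) (M : S → S → ℝ) (hd : IsDistribution d)
    (h0 : ∀ i j, 0 ≤ M i j) (h1 : ∀ i, ∑ j, M i j = 1) : IsDistribution (dApply d M) := by
  refine ⟨fun s => Finset.sum_nonneg fun i _ => mul_nonneg (hd.1 i) (h0 i s), ?_⟩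
  unfold dApply
  rw [Finset.sum_comm]
  simp only [← Finset.mul_sum, h1, mul_one, hd.2]

theorem aux_pmat {S A : Type*} [Fintype S] [Fintype A] (P : S → A → S → ℝ) (hP : IsTransition P)
    (p : S → A → ℝ) (hp : IsPolicy p) :
    (∀ i j, 0 ≤ pmat P p i j) ∧ (∀ i, ∑ j, pmat P p i j = 1) := by
  refine ⟨fun i j => Finset.sum_nonneg fun a _ => mul_nonneg (hp.1 i a) (hP.1 i a j), fun i => ?_⟩
  unfold pmat
  rw [Finset.sum_comm]
  simp only [← Finset.mul_sum, hP.2, mul_one, hp.2]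

theorem aux_rollout {S A : Type*} [Fintype S] [Fintype A] (P : S → A → S → ℝ)
    (hP : IsTransition P) (p : ℕ → S → A → ℝ) (hp : ∀ k, IsPolicy (p k)) (d : S → ℝ)
    (hd : IsDistribution d) (k : ℕ) : IsDistribution (rollout P p d k) := by
  induction k with
  | zero => exact hd
  | succ k ih =>
    exact aux_dApply _ _ ih (aux_pmat P hP _ (hp k)).1 (aux_pmat P hP _ (hp k)).2

theorem aux_rpol {S A : Type*} [Fintype A] (r : S → A → ℝ)
    (hr : ∀ s a, 0 ≤ r s a ∧ r s a ≤ 1) (p : S → A → ℝ) (hp : IsPolicy p) (s : S) :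
    0 ≤ rpol r p s ∧ rpol r p s ≤ 1 :=
  ⟨Finset.sum_nonneg fun a _ => mul_nonneg (hp.1 s a) (hr s a).1,
    aux_avg (p s) (r s) 1 ⟨hp.1 s, hp.2 s⟩ fun a => (hr s a).2⟩

theorem aux_step {S A : Type*} [Fintype S] [Fintype A] (P : S → A → S → ℝ)
    (hP : IsTransition P) (p q : S → A → ℝ) (hp : IsPolicy p) (ε : ℝ)
    (hpq : ∀ s, ∑ a, |p s a - q s a| ≤ ε) (d e : S → ℝ) (he : IsDistribution e) :
    ∑ s, |dApply d (pmat P p) s - dApply e (pmat P q) s| ≤ (∑ s, |d s - e s|) + ε := by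
  have key : ∀ s, dApply d (pmat P p) s - dApply e (pmat P q) s =
      (∑ i, (d i - e i) * pmat P p i s) + ∑ i, e i * (∑ a, (p i a - q i a) * P i a s) := by
    intro s
    unfold dApply
    rw [← Finset.sum_sub_distrib, ← Finset.sum_add_distrib]
    refine Finset.sum_congr rfl fun i _ => ?_
    have : ∑ a, (p i a - q i a) * P i a s = pmat P p i s - pmat P q i s := by
      unfold pmat
      rw [← Finset.sum_sub_distrib]
      exact Finset.sum_congr rfl fun a _ => by ring
    rw [this]; ring
  have h1 := aux_l1 (fun i => d i - e i) (pmat P p) (aux_pmat P hP p hp).1 (aux_pmat P hP p hp).2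
  have h2 : ∑ s, |∑ i, e i * (∑ a, (p i a - q i a) * P i a s)| ≤ ε := by
    calc ∑ s, |∑ i, e i * (∑ a, (p i a - q i a) * P i a s)|
        ≤ ∑ s, ∑ i, e i * |∑ a, (p i a - q i a) * P i a s| := by
          refine Finset.sum_le_sum fun s _ => ?_
          refine (Finset.abs_sum_le_sum_abs _ _).trans (le_of_eq ?_)
          refine Finset.sum_congr rfl fun i _ => ?_
          rw [abs_mul, abs_of_nonneg (he.1 i)]
      _ = ∑ i, e i * ∑ s, |∑ a, (p i a - q i a) * P i a s| := by
          rw [Finset.sum_comm]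
          simp only [Finset.mul_sum]
      _ ≤ ε := aux_avg _ _ _ he fun i =>
          (aux_l1 (fun a => p i a - q i a) (P i) (hP.1 i) (hP.2 i)).trans (hpq i)
  calc _ ≤ ∑ s, (|∑ i, (d i - e i) * pmat P p i s|
          + |∑ i, e i * (∑ a, (p i a - q i a) * P i a s)|) := by
        refine Finset.sum_le_sum fun s _ => ?_
        rw [key]; exact abs_add_le _ _
    _ ≤ _ := by rw [Finset.sum_add_distrib]; exact add_le_add h1 h2

theorem aux_rollout_diff {S A : Type*} [Fintype S] [Fintype A] (P : S → A → S → ℝ)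
    (hP : IsTransition P) (p : ℕ → S → A → ℝ) (hp : ∀ k, IsPolicy (p k)) (q : S → A → ℝ)
    (hq : IsPolicy q) (c : ℝ) (hpq : ∀ k s, ∑ a, |p k s a - q s a| ≤ ((k : ℝ) + 1) * c)
    (d : S → ℝ) (hd : IsDistribution d) (k : ℕ) :
    ∑ s, |rollout P p d k s - rollout P (fun _ => q) d k s| ≤ (k : ℝ) * (k + 1) / 2 * c := by
  induction k with
  | zero => simp [rollout]
  | succ k ih =>
    have := aux_step P hP (p k) q (hp k) _ (hpq k) (rollout P p d k) (rollout P (fun _ => q) d k)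
      (aux_rollout P hP _ (fun _ => hq) d hd k)
    simp only [rollout]
    push_cast
    linarith

theorem aux_term {S A : Type*} [Fintype S] [Fintype A] (r : S → A → ℝ)
    (hr : ∀ s a, 0 ≤ r s a ∧ r s a ≤ 1) (p q : S → A → ℝ) (hp : IsPolicy p) (ε δ : ℝ)
    (hpq : ∀ s, ∑ a, |p s a - q s a| ≤ ε) (d e : S → ℝ) (he : IsDistribution e)
    (hde : ∑ s, |d s - e s| ≤ δ) :
    |∑ s, d s * rpol r p s - ∑ s, e s * rpol r q s| ≤ δ + ε := by
  have key : ∑ s, d s * rpol r p s - ∑ s, e s * rpol r q s =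
      ∑ s, (d s - e s) * rpol r p s + ∑ s, e s * (rpol r p s - rpol r q s) := by
    rw [← Finset.sum_sub_distrib, ← Finset.sum_add_distrib]
    exact Finset.sum_congr rfl fun s _ => by ring
  have h1 : |∑ s, (d s - e s) * rpol r p s| ≤ δ := by
    refine (Finset.abs_sum_le_sum_abs _ _).trans (le_trans (Finset.sum_le_sum fun s _ => ?_) hde)
    have := aux_rpol r hr p hp s
    rw [abs_mul, abs_of_nonneg this.1]
    exact mul_le_of_le_one_right (abs_nonneg _) this.2
  have h3 : ∀ s, |rpol r p s - rpol r q s| ≤ ε := by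
    intro s
    unfold rpol
    rw [← Finset.sum_sub_distrib]
    refine (Finset.abs_sum_le_sum_abs _ _).trans (le_trans (Finset.sum_le_sum fun a _ => ?_) (hpq s))
    rw [← sub_mul, abs_mul, abs_of_nonneg (hr s a).1]
    exact mul_le_of_le_one_right (abs_nonneg _) (hr s a).2
  have h2 : |∑ s, e s * (rpol r p s - rpol r q s)| ≤ ε := by
    refine (Finset.abs_sum_le_sum_abs _ _).trans (le_trans (le_of_eq ?_) (aux_avg e _ ε he h3))
    refine Finset.sum_congr rfl fun s _ => ?_
    rw [abs_mul, abs_of_nonneg (he.1 s)]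
  rw [key]
  exact (abs_add_le _ _).trans (add_le_add h1 h2)

theorem stmt8 {S A : Type*} [Fintype S] [Fintype A] [Nonempty S] [Nonempty A]
    (γ : ℝ) (hγ0 : 0 < γ) (hγ1 : γ < 1)
    (P : S → A → S → ℝ) (hP : IsTransition P)
    (r : S → A → ℝ) (hr : ∀ s a, 0 ≤ r s a ∧ r s a ≤ 1)
    (π : ℕ → S → A → ℝ) (hπ : ∀ t, 1 ≤ t → IsPolicy (π t))
    (cT : ℝ) (hslow : ∀ t, 1 ≤ t → ∀ s, ∑ a, |π (t + 1) s a - π t s a| ≤ cT)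
    (T : ℝ) (hT : 1 ≤ T) (H : ℕ) (hH : γ ^ H ≤ (1 - γ) / Real.sqrt T)
    (t : ℕ) (ht : 1 ≤ t) (s : S) (a : A) :
    |Ubar γ P r π t H s a - Qval γ P r (π t) s a|
      ≤ ((H : ℝ) * Fintype.card S + (H : ℝ) ^ 2 * Fintype.card A) * cT / (1 - γ)
        + 1 / Real.sqrt T := by
  have hpol : ∀ j, IsPolicy (π (t + 1 + j)) := fun j => hπ _ (by omega)
  have hd : IsDistribution (fun s'' => P s a s'') := ⟨hP.1 s a, hP.2 s a⟩
  have hc : 0 ≤ cT := le_trans (Finset.sum_nonneg fun _ _ => abs_nonneg _) (hslow t ht s)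
  have hdrift : ∀ k s, ∑ a, |π (t + 1 + k) s a - π t s a| ≤ ((k : ℝ) + 1) * cT := by
    intro k s
    induction k with
    | zero => simpa using hslow t ht s
    | succ k ih =>
      have h1 := hslow (t + 1 + k) (by omega) s
      have h2 : ∑ a, |π (t + 1 + (k + 1)) s a - π t s a| ≤
          ∑ a, (|π (t + 1 + k + 1) s a - π (t + 1 + k) s a| + |π (t + 1 + k) s a - π t s a|) :=
        Finset.sum_le_sum fun a _ => abs_sub_le _ _ _
      rw [Finset.sum_add_distrib] at h2
      push_cast
      linarith
  set u : ℕ → ℝ := fun k => ∑ s', rollout P (fun j => π (t + 1 + j)) (fun s'' => P s a s'') k s' *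
      rpol r (π (t + 1 + k)) s' with hu
  set v : ℕ → ℝ := fun k =>
    ∑ s', rollout P (fun _ => π t) (fun s'' => P s a s'') k s' * rpol r (π t) s' with hv
  have hroll : ∀ k, IsDistribution (rollout P (fun _ => π t) (fun s'' => P s a s'') k) :=
    fun k => aux_rollout P hP _ (fun _ => hπ t ht) _ hd k
  have hv0 : ∀ k, 0 ≤ v k := fun k => Finset.sum_nonneg fun s' _ =>
    mul_nonneg ((hroll k).1 s') (aux_rpol r hr _ (hπ t ht) s').1
  have hv1 : ∀ k, v k ≤ 1 := fun k =>
    aux_avg _ _ 1 (hroll k) fun s' => (aux_rpol r hr _ (hπ t ht) s').2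
  have huv : ∀ k, |u k - v k| ≤ ((k : ℝ) + 1) * (k + 2) / 2 * cT := by
    intro k
    have := aux_term r hr (π (t + 1 + k)) (π t) (hpol k) _ _ (hdrift k)
      (rollout P (fun j => π (t + 1 + j)) (fun s'' => P s a s'') k) _ (hroll k)
      (aux_rollout_diff P hP (fun j => π (t + 1 + j)) hpol (π t) (hπ t ht) cT hdrift _ hd k)
    refine this.trans (le_of_eq ?_)
    ring
  have hg : 0 < 1 - γ := by linarith
  have hgs : Summable fun k : ℕ => γ ^ (k + 1) := by
    simpa [pow_succ] using (summable_geometric_of_lt_one hγ0.le hγ1).mul_right γ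
  have hsum : Summable fun k => γ ^ (k + 1) * v k :=
    Summable.of_nonneg_of_le (fun k => mul_nonneg (by positivity) (hv0 k))
      (fun k => mul_le_of_le_one_right (by positivity) (hv1 k)) hgs
  have hsplit := hsum.sum_add_tsum_nat_add H
  have htail0 : 0 ≤ ∑' k, γ ^ (k + H + 1) * v (k + H) :=
    tsum_nonneg fun k => mul_nonneg (by positivity) (hv0 _)
  have htail1 : ∑' k, γ ^ (k + H + 1) * v (k + H) ≤ 1 / Real.sqrt T := by
    have hge : HasSum (fun k : ℕ => γ ^ (H + 1) * γ ^ k) (γ ^ (H + 1) * (1 - γ)⁻¹) :=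
      (hasSum_geometric_of_lt_one hγ0.le hγ1).mul_left _
    have h1 : ∑' k, γ ^ (k + H + 1) * v (k + H) ≤ γ ^ (H + 1) * (1 - γ)⁻¹ := by
      rw [← hge.tsum_eq]
      refine Summable.tsum_le_tsum (fun k => ?_) ((summable_nat_add_iff H).2 hsum) hge.summable
      refine (mul_le_of_le_one_right (by positivity) (hv1 _)).trans (le_of_eq ?_)
      ring
    refine h1.trans ?_
    have h2 : γ ^ (H + 1) ≤ (1 - γ) / Real.sqrt T :=
      (pow_le_pow_of_le_one hγ0.le hγ1.le (Nat.le_succ H)).trans hH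
    calc γ ^ (H + 1) * (1 - γ)⁻¹ ≤ (1 - γ) / Real.sqrt T * (1 - γ)⁻¹ :=
          mul_le_mul_of_nonneg_right h2 (by positivity)
      _ = 1 / Real.sqrt T := by field_simp
  have hS : (1 : ℝ) ≤ Fintype.card S := by exact_mod_cast Fintype.card_pos
  have hA : (1 : ℝ) ≤ Fintype.card A := by exact_mod_cast Fintype.card_pos
  set B : ℝ := ((H : ℝ) * Fintype.card S + (H : ℝ) ^ 2 * Fintype.card A) * cT with hB
  have hB0 : 0 ≤ B := by positivity
  have hkB : ∀ k ∈ Finset.range H, |u k - v k| ≤ B := by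
    intro k hk
    have hk' : (k : ℝ) + 1 ≤ H := by exact_mod_cast Finset.mem_range.1 hk
    have hk0 : (0 : ℝ) ≤ k := Nat.cast_nonneg k
    refine (huv k).trans (mul_le_mul_of_nonneg_right ?_ hc)
    have e1 : (H : ℝ) ≤ H * Fintype.card S := le_mul_of_one_le_right (by linarith) hS
    have e2 : (H : ℝ) ^ 2 ≤ (H : ℝ) ^ 2 * Fintype.card A :=
      le_mul_of_one_le_right (by positivity) hA
    nlinarith
  have hmain : |∑ k ∈ Finset.range H, (γ ^ (k + 1) * u k - γ ^ (k + 1) * v k)| ≤ B / (1 - γ) := by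
    calc _ ≤ ∑ k ∈ Finset.range H, γ ^ k * B := by
          refine (Finset.abs_sum_le_sum_abs _ _).trans (Finset.sum_le_sum fun k hk => ?_)
          rw [← mul_sub, abs_mul, abs_of_nonneg (by positivity)]
          exact mul_le_mul (pow_le_pow_of_le_one hγ0.le hγ1.le (Nat.le_succ k)) (hkB k hk)
            (abs_nonneg _) (by positivity)
      _ = (∑ k ∈ Finset.range H, γ ^ k) * B := by rw [Finset.sum_mul]
      _ ≤ (1 - γ)⁻¹ * B := by
          refine mul_le_mul_of_nonneg_right ?_ hB0
          rw [← tsum_geometric_of_lt_one hγ0.le hγ1]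
          exact (summable_geometric_of_lt_one hγ0.le hγ1).sum_le_tsum _
            (fun k _ => by positivity)
      _ = B / (1 - γ) := by rw [div_eq_inv_mul]
  have heq : Ubar γ P r π t H s a - Qval γ P r (π t) s a =
      (∑ k ∈ Finset.range H, (γ ^ (k + 1) * u k - γ ^ (k + 1) * v k))
        - ∑' k, γ ^ (k + H + 1) * v (k + H) := by
    have e1 : Ubar γ P r π t H s a = r s a + ∑ k ∈ Finset.range H, γ ^ (k + 1) * u k := rfl
    have e2 : Qval γ P r (π t) s a = r s a + ∑' k, γ ^ (k + 1) * v k := rfl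
    rw [e1, e2, ← hsplit, Finset.sum_sub_distrib]
    ring
  rw [heq]
  refine (abs_sub _ _).trans (add_le_add hmain ?_)
  rw [abs_of_nonneg htail0]
  exact htail1
end

section
/- Let (π_t)_{t≥1} be a sequence of policies with ‖π_{t+1} − π_t‖_{1,∞} ≤ c_T for every t, let T ≥ 1 be a real number, and let H be a natural number with γ^H ≤ (1−γ)/√T. Then for all natural numbers t ≥ 1 and n, and every (s,a) ∈ 𝒮 × 𝒜: |Q^{π_{t+n}}(s,a) − Q^{π_t}(s,a)| ≤ (S + HA)·n·c_T/(1−γ) + 2/√T. -/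
open Finset

lemma pmat_dist {S A : Type*} [Fintype S] [Fintype A] {P : S → A → S → ℝ} (hP : IsTransition P)
    {p : S → A → ℝ} (hp : IsPolicy p) (s : S) : IsDistribution (pmat P p s) := by
  refine ⟨fun s' => Finset.sum_nonneg fun a _ => mul_nonneg (hp.1 s a) (hP.1 s a s'), ?_⟩
  unfold pmat
  rw [Finset.sum_comm]
  simp_rw [← Finset.mul_sum, hP.2, mul_one]
  exact hp.2 s

lemma rollout_dist {S A : Type*} [Fintype S] [Fintype A] {P : S → A → S → ℝ} (hP : IsTransition P)
    {p : S → A → ℝ} (hp : IsPolicy p) {d : S → ℝ} (hd : IsDistribution d) (k : ℕ) :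
    IsDistribution (rollout P (fun _ => p) d k) := by
  induction k with
  | zero => exact hd
  | succ k ih =>
    refine ⟨fun s' => Finset.sum_nonneg fun s _ =>
      mul_nonneg (ih.1 s) ((pmat_dist hP hp s).1 s'), ?_⟩
    simp only [rollout, dApply]
    rw [Finset.sum_comm]
    simp_rw [← Finset.mul_sum, (pmat_dist hP hp _).2, mul_one]
    exact ih.2

lemma pmat_diff {S A : Type*} [Fintype S] [Fintype A] {P : S → A → S → ℝ} (hP : IsTransition P)
    {p q : S → A → ℝ} {δ : ℝ} (h : ∀ s, ∑ a, |p s a - q s a| ≤ δ) (s : S) :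
    ∑ s', |pmat P p s s' - pmat P q s s'| ≤ δ := by
  refine le_trans ?_ (h s)
  calc ∑ s', |pmat P p s s' - pmat P q s s'|
      ≤ ∑ s', ∑ a, |p s a - q s a| * P s a s' := by
        refine Finset.sum_le_sum fun s' _ => ?_
        unfold pmat
        rw [← Finset.sum_sub_distrib]
        refine (Finset.abs_sum_le_sum_abs _ _).trans (Finset.sum_le_sum fun a _ => ?_)
        rw [← sub_mul, abs_mul, abs_of_nonneg (hP.1 s a s')]
    _ = ∑ a, |p s a - q s a| := by
        rw [Finset.sum_comm]
        simp_rw [← Finset.mul_sum, hP.2, mul_one]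

lemma rollout_diff {S A : Type*} [Fintype S] [Fintype A] {P : S → A → S → ℝ} (hP : IsTransition P)
    {p q : S → A → ℝ} (hp : IsPolicy p) (hq : IsPolicy q) {δ : ℝ}
    (h : ∀ s, ∑ a, |p s a - q s a| ≤ δ) {d : S → ℝ} (hd : IsDistribution d) (k : ℕ) :
    ∑ s, |rollout P (fun _ => p) d k s - rollout P (fun _ => q) d k s| ≤ k * δ := by
  induction k with
  | zero => simp [rollout]
  | succ k ih =>
    simp only [rollout, dApply]
    set u := rollout P (fun _ => p) d k
    set v := rollout P (fun _ => q) d k with hv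
    have hvd : IsDistribution v := rollout_dist hP hq hd k
    calc _ ≤ ∑ s', ∑ s, (|u s - v s| * pmat P p s s' + v s * |pmat P p s s' - pmat P q s s'|) := by
          refine Finset.sum_le_sum fun s' _ => ?_
          rw [← Finset.sum_sub_distrib]
          refine (Finset.abs_sum_le_sum_abs _ _).trans (Finset.sum_le_sum fun s _ => ?_)
          have e : u s * pmat P p s s' - v s * pmat P q s s'
            = (u s - v s) * pmat P p s s' + v s * (pmat P p s s' - pmat P q s s') := by ring
          rw [e]
          refine (abs_add_le _ _).trans ?_
          rw [abs_mul, abs_mul, abs_of_nonneg ((pmat_dist hP hp s).1 s'),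
            abs_of_nonneg (hvd.1 s)]
      _ = ∑ s, |u s - v s| + ∑ s, v s * ∑ s', |pmat P p s s' - pmat P q s s'| := by
          rw [Finset.sum_comm]
          simp_rw [Finset.sum_add_distrib, ← Finset.mul_sum, (pmat_dist hP hp _).2, mul_one]
      _ ≤ k * δ + ∑ s, v s * δ := by
          refine add_le_add ih (Finset.sum_le_sum fun s _ => ?_)
          exact mul_le_mul_of_nonneg_left (pmat_diff hP h s) (hvd.1 s)
      _ = _ := by rw [← Finset.sum_mul, hvd.2]; push_cast; ring

lemma rpol_mem {S A : Type*} [Fintype A] {r : S → A → ℝ}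
    (hr : ∀ s a, 0 ≤ r s a ∧ r s a ≤ 1) {p : S → A → ℝ} (hp : IsPolicy p) (s : S) :
    0 ≤ rpol r p s ∧ rpol r p s ≤ 1 := by
  refine ⟨Finset.sum_nonneg fun a _ => mul_nonneg (hp.1 s a) (hr s a).1, ?_⟩
  rw [← hp.2 s]
  exact Finset.sum_le_sum fun a _ => mul_le_of_le_one_right (hp.1 s a) (hr s a).2

lemma rpol_diff {S A : Type*} [Fintype A] {r : S → A → ℝ}
    (hr : ∀ s a, 0 ≤ r s a ∧ r s a ≤ 1) {p q : S → A → ℝ} {δ : ℝ}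
    (h : ∀ s, ∑ a, |p s a - q s a| ≤ δ) (s : S) : |rpol r p s - rpol r q s| ≤ δ := by
  refine le_trans ?_ (h s)
  unfold rpol
  rw [← Finset.sum_sub_distrib]
  refine (Finset.abs_sum_le_sum_abs _ _).trans (Finset.sum_le_sum fun a _ => ?_)
  rw [← sub_mul, abs_mul, abs_of_nonneg (hr s a).1]
  exact mul_le_of_le_one_right (abs_nonneg _) (hr s a).2

/-- Expected reward of a distribution lies in the unit interval. -/
lemma ev_mem {S : Type*} [Fintype S] {d f : S → ℝ} (hd : IsDistribution d)
    (hf : ∀ s, 0 ≤ f s ∧ f s ≤ 1) : 0 ≤ ∑ s, d s * f s ∧ ∑ s, d s * f s ≤ 1 := by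
  refine ⟨Finset.sum_nonneg fun a _ => mul_nonneg (hd.1 a) (hf a).1, ?_⟩
  rw [← hd.2]
  exact Finset.sum_le_sum fun a _ => mul_le_of_le_one_right (hd.1 a) (hf a).2

lemma ev_diff {S : Type*} [Fintype S] {u v f g : S → ℝ} (hv : IsDistribution v)
    (hf : ∀ s, 0 ≤ f s ∧ f s ≤ 1) {D δ : ℝ} (huv : ∑ s, |u s - v s| ≤ D)
    (hfg : ∀ s, |f s - g s| ≤ δ) : |∑ s, u s * f s - ∑ s, v s * g s| ≤ D + δ := by
  rw [← Finset.sum_sub_distrib]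
  calc _ ≤ ∑ s, (|u s - v s| + v s * δ) := by
        refine (Finset.abs_sum_le_sum_abs _ _).trans (Finset.sum_le_sum fun s _ => ?_)
        have e : u s * f s - v s * g s = (u s - v s) * f s + v s * (f s - g s) := by ring
        rw [e]
        refine (abs_add_le _ _).trans ?_
        rw [abs_mul, abs_mul, abs_of_nonneg (hf s).1, abs_of_nonneg (hv.1 s)]
        exact add_le_add (mul_le_of_le_one_right (abs_nonneg _) (hf s).2)
          (mul_le_mul_of_nonneg_left (hfg s) (hv.1 s))
    _ ≤ D + δ := by
        rw [Finset.sum_add_distrib, ← Finset.sum_mul, hv.2, one_mul]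
        linarith

/-- Abstract discounted-series comparison. -/
lemma series_bound {γ : ℝ} (hγ0 : 0 < γ) (hγ1 : γ < 1) {x y : ℕ → ℝ}
    (hx : ∀ k, 0 ≤ x k ∧ x k ≤ 1) (hy : ∀ k, 0 ≤ y k ∧ y k ≤ 1) {δ : ℝ} (hδ : 0 ≤ δ)
    (hxy : ∀ k : ℕ, |x k - y k| ≤ k * δ + δ) (H : ℕ) :
    |∑' k, γ ^ (k + 1) * x k - ∑' k, γ ^ (k + 1) * y k|
      ≤ H * δ / (1 - γ) + γ ^ H / (1 - γ) := by
  have hg : Summable (fun k : ℕ => γ ^ k) := summable_geometric_of_lt_one hγ0.le hγ1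
  have hle : ∀ k : ℕ, γ ^ (k + 1) ≤ γ ^ k := fun k =>
    pow_le_pow_of_le_one hγ0.le hγ1.le (Nat.le_succ k)
  have hs : ∀ z : ℕ → ℝ, (∀ k, 0 ≤ z k ∧ z k ≤ 1) → Summable (fun k => γ ^ (k + 1) * z k) := by
    intro z hz
    refine Summable.of_nonneg_of_le (fun k => mul_nonneg (by positivity) (hz k).1) (fun k => ?_) hg
    exact (mul_le_of_le_one_right (by positivity) (hz k).2).trans (hle k)
  have hfs := (hs x hx).sub (hs y hy)
  rw [← (hs x hx).tsum_sub (hs y hy), ← hfs.sum_add_tsum_nat_add H]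
  have habs : ∀ k, |γ ^ (k + 1) * x k - γ ^ (k + 1) * y k| = γ ^ (k + 1) * |x k - y k| := by
    intro k
    rw [← mul_sub, abs_mul, abs_of_nonneg (by positivity)]
  refine (abs_add_le _ _).trans (add_le_add ?_ ?_)
  · refine (Finset.abs_sum_le_sum_abs _ _).trans ?_
    calc _ ≤ ∑ k ∈ Finset.range H, γ ^ k * (H * δ) := by
          refine Finset.sum_le_sum fun k hk => ?_
          rw [habs]
          have hk' : ((k : ℝ) + 1) ≤ H := by
            exact_mod_cast Finset.mem_range.1 hk
          refine mul_le_mul (hle k) ?_ (abs_nonneg _) (by positivity)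
          nlinarith [hxy k]
      _ = (∑ k ∈ Finset.range H, γ ^ k) * (H * δ) := by rw [Finset.sum_mul]
      _ ≤ (1 - γ)⁻¹ * (H * δ) := by
          refine mul_le_mul_of_nonneg_right ?_ (by positivity)
          rw [← tsum_geometric_of_lt_one hγ0.le hγ1]
          exact hg.sum_le_tsum _ (fun k _ => by positivity)
      _ = _ := by rw [div_eq_inv_mul]
  · rw [← Real.norm_eq_abs]
    have hh : HasSum (fun k : ℕ => γ ^ H * γ ^ k) (γ ^ H / (1 - γ)) :=
      (hasSum_geometric_of_lt_one hγ0.le hγ1).mul_left _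
    refine tsum_of_norm_bounded hh fun k => ?_
    rw [Real.norm_eq_abs, habs, ← pow_add, add_comm H k]
    refine (mul_le_of_le_one_right (by positivity) ?_).trans (hle _)
    rw [abs_le]
    constructor <;> linarith [(hx (k + H)).1, (hx (k + H)).2, (hy (k + H)).1, (hy (k + H)).2]

theorem stmt10 {S A : Type*} [Fintype S] [Fintype A] [Nonempty S] [Nonempty A]
    (γ : ℝ) (hγ0 : 0 < γ) (hγ1 : γ < 1)
    (P : S → A → S → ℝ) (hP : IsTransition P)
    (r : S → A → ℝ) (hr : ∀ s a, 0 ≤ r s a ∧ r s a ≤ 1)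
    (π : ℕ → S → A → ℝ) (hπ : ∀ t, 1 ≤ t → IsPolicy (π t))
    (cT : ℝ) (hslow : ∀ t, 1 ≤ t → ∀ s, ∑ a, |π (t + 1) s a - π t s a| ≤ cT)
    (T : ℝ) (hT : 1 ≤ T) (H : ℕ) (hH : γ ^ H ≤ (1 - γ) / Real.sqrt T)
    (t n : ℕ) (ht : 1 ≤ t) (s : S) (a : A) :
    |Qval γ P r (π (t + n)) s a - Qval γ P r (π t) s a|
      ≤ ((Fintype.card S : ℝ) + (H : ℝ) * Fintype.card A) * n * cT / (1 - γ)
        + 2 / Real.sqrt T := by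
  have hc : 0 ≤ cT := (Finset.sum_nonneg fun a _ => abs_nonneg _).trans (hslow 1 le_rfl s)
  have hdrift : ∀ s, ∑ a, |π (t + n) s a - π t s a| ≤ n * cT := by
    intro s
    induction n with
    | zero => simp
    | succ n ih =>
      calc _ ≤ ∑ a, (|π (t + n + 1) s a - π (t + n) s a| + |π (t + n) s a - π t s a|) :=
            Finset.sum_le_sum fun a _ => abs_sub_le _ _ _
        _ ≤ cT + n * cT := by
            rw [Finset.sum_add_distrib]
            exact add_le_add (hslow (t + n) (by omega) s) ih
        _ = _ := by push_cast; ring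
  have hp := hπ (t + n) (by omega)
  have hq := hπ t ht
  have hd : IsDistribution (fun s'' => P s a s'') := ⟨hP.1 s a, hP.2 s a⟩
  have hδ : 0 ≤ (n : ℝ) * cT := by positivity
  have key := series_bound hγ0 hγ1
    (fun k => ev_mem (rollout_dist hP hp hd k) (rpol_mem hr hp))
    (fun k => ev_mem (rollout_dist hP hq hd k) (rpol_mem hr hq)) hδ
    (fun k => ev_diff (rollout_dist hP hq hd k) (rpol_mem hr hp)
      (rollout_diff hP hp hq hdrift hd k) (rpol_diff hr hdrift)) H
  have h1 : 0 < 1 - γ := by linarith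
  have hT' : 0 < Real.sqrt T := Real.sqrt_pos.2 (by linarith)
  have hA : (1 : ℝ) ≤ Fintype.card A := by exact_mod_cast Fintype.card_pos
  unfold Qval
  rw [add_sub_add_left_eq_sub]
  refine key.trans (add_le_add ?_ ?_)
  · rw [mul_assoc]
    refine div_le_div_of_nonneg_right (mul_le_mul_of_nonneg_right ?_ hδ) h1.le
    have : (H : ℝ) ≤ H * Fintype.card A := le_mul_of_one_le_right (by positivity) hA
    have : (0 : ℝ) ≤ Fintype.card S := by positivity
    linarith
  · rw [div_le_iff₀ h1]
    refine hH.trans ?_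
    rw [div_mul_eq_mul_div]
    exact div_le_div_of_nonneg_right (by linarith) hT'.le
end
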